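/- The set of 10-element cliques in C with weights in {1,2} whose weight-2 graph is a disjoint union of two 5-cycles has exactly 6,967,296 elements and forms a single W-orbit, and the stabilizer in W of any such clique has order 100. -/

import Mathlib

/-- The intersection pairing on `ℤ⁹`, the Picard lattice of a del Pezzo surface of degree 1. -/
def B (v w : Fin 9 → ℤ) : ℤ := v 0 * w 0 - ∑ i : Fin 8, v i.succ * w i.succ

/-- The canonical class `K = (-3, -1, …, -1)`. -/
def Kcl : Fin 9 → ℤ := fun i => if i = 0 then -3 else -1

/-- A vector is an exceptional class if `B(v,v) = -1` and `B(v,K) = -1`. -/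
def IsExc (v : Fin 9 → ℤ) : Prop := B v v = -1 ∧ B v Kcl = -1

/-- The type of exceptional classes (the set `C`). -/
abbrev Exc : Type := {v : Fin 9 → ℤ // IsExc v}

/-- The pairing on exceptional classes. -/
def Bx (x y : Exc) : ℤ := B x.1 y.1

/-- `S` is a clique with weights in `M` if `B(x,y) ∈ M` for all distinct `x, y ∈ S`. -/
def IsClique (M : Set ℤ) (S : Finset Exc) : Prop :=
  ∀ x ∈ S, ∀ y ∈ S, x ≠ y → Bx x y ∈ M

/-- A bijection of `C` preserving the pairing `B`: an element of the Weyl group `W`. -/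
def PreservesB (g : Exc ≃ Exc) : Prop := ∀ x y : Exc, Bx (g x) (g y) = Bx x y

/-- Two finite subsets of `C` lie in the same orbit of `W`. -/
def SameOrbit (S T : Finset Exc) : Prop :=
  ∃ g : Exc ≃ Exc, PreservesB g ∧ S.image g = T

/-- The weight-2 graph of the clique `S` is (isomorphic to) the graph on `Fin 10` in which
`i ≠ j` are adjacent iff `p i j`. -/
def HasWeight2Graph (p : Fin 10 → Fin 10 → Prop) (S : Finset Exc) : Prop :=
  ∃ σ : Fin 10 ≃ {x // x ∈ S}, ∀ i j : Fin 10, i ≠ j → (Bx (σ i).1 (σ j).1 = 2 ↔ p i j)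

/-- Adjacency in a disjoint union of two 5-cycles (`{0,…,4}` and `{5,…,9}`, each in cyclic
order): same block of five, and cyclically consecutive. -/
def adjCC (i j : Fin 10) : Prop :=
  i.1 / 5 = j.1 / 5 ∧ ((i.1 % 5 + 1) % 5 = j.1 % 5 ∨ (j.1 % 5 + 1) % 5 = i.1 % 5)

/-! ### Computational part: list model of the exceptional classes -/

/-- dot product of lists -/
def dotL : List ℤ → List ℤ → ℤ
  | a :: l, b :: m => a * b + dotL l m
  | _, _ => 0

/-- the pairing on lists -/
def Bl : List ℤ → List ℤ → ℤ
  | a :: l, b :: m => a * b - dotL l m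
  | _, _ => 0

def rng : List ℤ := [-7, -6, -5, -4, -3, -2, -1, 0, 1, 2, 3, 4, 5, 6, 7]

/-- lists of length `k` with sum `s` and sum of squares `q` -/
def gen : ℕ → ℤ → ℤ → List (List ℤ)
  | 0, s, q => if s = 0 ∧ q = 0 then [[]] else []
  | k + 1, s, q => rng.flatMap fun n =>
      if (s - n) * (s - n) ≤ (k : ℤ) * (q - n * n) then
        (gen k (s - n) (q - n * n)).map (n :: ·) else []

/-- all exceptional classes -/
def LG : List (List ℤ) :=
  rng.flatMap fun a => if a < -1 then [] else (gen 8 (3 * a - 1) (a * a + 1)).map (a :: ·)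

/-- digits of a code, each lowered by one -/
def decN : ℕ → ℕ → List ℤ → List ℤ
  | 0, _, acc => acc
  | k + 1, n, acc => decN k (n / 10) (Int.subNatNat (n % 10) 1 :: acc)

/-- decimal codes of the exceptional classes -/
def LC : List ℕ :=
  [101111111, 110111111, 111011111, 111101111, 111110111, 111111011, 111111101, 111111110,
   211111122, 211111212, 211111221, 211112112, 211112121, 211112211, 211121112, 211121121,
   211121211, 211122111, 211211112, 211211121, 211211211, 211212111, 211221111, 212111112,
   212111121, 212111211, 212112111, 212121111, 212211111, 221111112, 221111121, 221111211,
   221112111, 221121111, 221211111, 222111111, 311122222, 311212222, 311221222, 311222122,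
   311222212, 311222221, 312112222, 312121222, 312122122, 312122212, 312122221, 312211222,
   312212122, 312212212, 312212221, 312221122, 312221212, 312221221, 312222112, 312222121,
   312222211, 321112222, 321121222, 321122122, 321122212, 321122221, 321211222, 321212122,
   321212212, 321212221, 321221122, 321221212, 321221221, 321222112, 321222121, 321222211,
   322111222, 322112122, 322112212, 322112221, 322121122, 322121212, 322121221, 322122112,
   322122121, 322122211, 322211122, 322211212, 322211221, 322212112, 322212121, 322212211,
   322221112, 322221121, 322221211, 322222111, 412222223, 412222232, 412222322, 412223222,
   412232222, 412322222, 413222222, 421222223, 421222232, 421222322, 421223222, 421232222,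
   421322222, 422122223, 422122232, 422122322, 422123222, 422132222, 422212223, 422212232,
   422212322, 422213222, 422221223, 422221232, 422221322, 422222123, 422222132, 422222213,
   422222231, 422222312, 422222321, 422223122, 422223212, 422223221, 422231222, 422232122,
   422232212, 422232221, 422312222, 422321222, 422322122, 422322212, 422322221, 423122222,
   423212222, 423221222, 423222122, 423222212, 423222221, 431222222, 432122222, 432212222,
   432221222, 432222122, 432222212, 432222221, 522222333, 522223233, 522223323, 522223332,
   522232233, 522232323, 522232332, 522233223, 522233232, 522233322, 522322233, 522322323,
   522322332, 522323223, 522323232, 522323322, 522332223, 522332232, 522332322, 522333222,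
   523222233, 523222323, 523222332, 523223223, 523223232, 523223322, 523232223, 523232232,
   523232322, 523233222, 523322223, 523322232, 523322322, 523323222, 523332222, 532222233,
   532222323, 532222332, 532223223, 532223232, 532223322, 532232223, 532232232, 532232322,
   532233222, 532322223, 532322232, 532322322, 532323222, 532332222, 533222223, 533222232,
   533222322, 533223222, 533232222, 533322222, 622333333, 623233333, 623323333, 623332333,
   623333233, 623333323, 623333332, 632233333, 632323333, 632332333, 632333233, 632333323,
   632333332, 633223333, 633232333, 633233233, 633233323, 633233332, 633322333, 633323233,
   633323323, 633323332, 633332233, 633332323, 633332332, 633333223, 633333232, 633333322,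
   733333334, 733333343, 733333433, 733334333, 733343333, 733433333, 734333333, 743333333]

/-- all exceptional classes, decoded -/
def LL : List (List ℤ) := LC.map fun n => decN 9 n []

/-- prescribed pairings of the `k`-th vector with the previous ones (latest first) -/
def row : ℕ → List ℤ
  | 1 => [2]
  | 2 => [2, 1]
  | 3 => [2, 1, 1]
  | 4 => [2, 1, 1, 2]
  | 5 => [1, 1, 1, 1, 1]
  | 6 => [2, 1, 1, 1, 1, 1]
  | 7 => [2, 1, 1, 1, 1, 1, 1]
  | 8 => [2, 1, 1, 1, 1, 1, 1, 1]
  | 9 => [2, 1, 1, 2, 1, 1, 1, 1, 1]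
  | _ => []

def cand {α : Type} (b : α → α → ℤ) (p : List α) (y : α) : Bool :=
  decide (p.map (fun x => b x y) = row p.length)

def enum {α : Type} (b : α → α → ℤ) (U : List α) : ℕ → List (List α)
  | 0 => [[]]
  | k + 1 => (enum b U k).flatMap fun p => (U.filter (cand b p)).map (· :: p)

def Fr {α : Type} (b : α → α → ℤ) : List α → Bool
  | [] => true
  | y :: p => Fr b p && cand b p y

def nxt (k : ℕ) : ℕ := [240, 56, 27, 16, 1, 20, 6, 2, 1, 1].getD k 0

def stepL (X cur : List (List ℤ)) : List (List ℤ) :=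
  X.filter fun y => cur.any fun z => decide (Bl z y = 0) || decide (z = y)

/-- base frame, latest vector first -/
def cL : List (List ℤ) :=
  [[4, 1, 1, 1, 1, 1, 2, 2, 2], [3, 1, 1, 1, 1, 2, 0, 1, 1], [3, 1, 1, 1, 1, 1, 2, 0, 1],
   [3, 1, 1, 1, 1, 1, 1, 2, 0], [2, 1, 1, 1, 1, 0, 0, 0, 1], [6, 2, 2, 2, 3, 2, 2, 2, 2],
   [3, 1, 1, 2, 0, 1, 1, 1, 1], [3, 1, 2, 0, 1, 1, 1, 1, 1], [3, 2, 0, 1, 1, 1, 1, 1, 1],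
   [0, -1, 0, 0, 0, 0, 0, 0, 0]]

/-- reflect the second cycle -/
def tau {α : Type} (l : List α) : List α := (l.take 4).reverse ++ l.drop 4

def preL (l : List (List ℤ)) (k : ℕ) : List (List ℤ) := l.drop (10 - k)

/-- canonical prefixes of length `k` (the two frames share their first six vectors) -/
def preS (k : ℕ) : List (List (List ℤ)) :=
  if k ≤ 6 then [preL cL k] else [preL cL k, preL (tau cL) k]

def XL (q : List (List ℤ)) : List (List ℤ) := LL.filter (cand Bl q)

/-- canonical one-step extensions of the canonical prefix `q` -/
def heads (k : ℕ) (q : List (List ℤ)) : List (List ℤ) :=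
  ((preS (k + 1)).filter fun r => decide (r.tail = q)).map
    fun r => r.headD []

/-- encode a list of small integers -/
def encL : List ℤ → ℕ
  | [] => 0
  | a :: l => (a + 1).toNat + 8 * encL l

lemma LG_eq : LG = LL := by decide +kernel

lemma LL_ok : ∀ l ∈ LL, l.length = 9 ∧ Bl l l = -1 ∧
    Bl l [-3, -1, -1, -1, -1, -1, -1, -1, -1] = -1 := by decide +kernel

lemma count_ok : ∀ k < 10, ∀ q ∈ preS k,
    (XL q).length = nxt k := by decide +kernel

lemma reach_ok : ∀ k < 10, ∀ q ∈ preS k,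
    stepL (XL q) (stepL (XL q) (stepL (XL q) (heads k q))) = XL q ∧
    ∀ h ∈ heads k q, cand Bl q h = true ∧ h ∈ LL := by decide +kernel

lemma enum_c : (enum Bl cL 10).length = 200 := by decide +kernel

lemma cL_sub : ∀ l ∈ cL, l ∈ LL := by decide +kernel

lemma cL_nodup : cL.Nodup := by decide +kernel

lemma tau_mem : Fr Bl (tau cL) = true := by decide +kernel
lemma c_mem : Fr Bl cL = true := by decide +kernel

lemma prof_nodup : (LL.map fun z => encL (cL.map fun x => Bl x z)).Nodup := by decide +kernel

lemma prof_ne : ∃ z ∈ LL, ∀ w ∈ LL,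
    (cL.map fun x => Bl x z) ≠ ((tau cL).map fun x => Bl x w) := by decide +kernel
/-! ### Transfer between classes and lists -/

def tt (x : Exc) : List ℤ := List.ofFn x.1

lemma tt_inj : Function.Injective tt := by
  intro x y h
  exact Subtype.ext (List.ofFn_injective h)

lemma Bl_ofFn (v w : Fin 9 → ℤ) : Bl (List.ofFn v) (List.ofFn w) = B v w := by
  simp [List.ofFn_succ, Bl, dotL, B, Fin.sum_univ_succ]

lemma Bx_tt (x y : Exc) : Bx x y = Bl (tt x) (tt y) := (Bl_ofFn x.1 y.1).symm

def sumsq (l : List ℤ) : ℤ := (l.map fun x => x * x).sum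

lemma cs_aux (x y : ℤ) (l : List ℤ) :
    0 ≤ y * y * sumsq l - 2 * (x * y * l.sum) + l.length * (x * x) := by
  induction l with
  | nil => simp [sumsq]
  | cons a l ih =>
    simp only [sumsq, List.map_cons, List.sum_cons, List.length_cons] at ih ⊢
    push_cast
    nlinarith [mul_self_nonneg (y * a - x)]

lemma cs (l : List ℤ) : l.sum * l.sum ≤ l.length * sumsq l := by
  rcases Nat.eq_zero_or_pos l.length with h | h
  · have : l = [] := List.length_eq_zero_iff.mp h
    subst this; simp [sumsq]
  · have h1 := cs_aux l.sum l.length l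
    have h2 : (0 : ℤ) < l.length := by exact_mod_cast h
    by_contra hc
    push Not at hc
    nlinarith

lemma mem_rng {n : ℤ} (h1 : -7 ≤ n) (h2 : n ≤ 7) : n ∈ rng := by
  interval_cases n <;> decide

lemma mem_gen (l : List ℤ) (hl : ∀ x ∈ l, x ∈ rng) : l ∈ gen l.length l.sum (sumsq l) := by
  induction l with
  | nil => simp [gen, sumsq]
  | cons a l ih =>
    have h0 := ih fun x hx => hl x (List.mem_cons_of_mem _ hx)
    have e1 : (a :: l).sum - a = l.sum := by simp
    have e2 : sumsq (a :: l) - a * a = sumsq l := by simp [sumsq]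
    simp only [List.length_cons, gen, List.mem_flatMap]
    refine ⟨a, hl a (by simp), ?_⟩
    rw [e1, e2, if_pos (cs l)]
    exact List.mem_map.mpr ⟨l, h0, rfl⟩

lemma tt_mem (x : Exc) : tt x ∈ LL := by
  obtain ⟨v, h1, h2⟩ := x
  rw [← LG_eq]
  set l := List.ofFn (fun i : Fin 8 => v i.succ) with hl
  have htt : tt ⟨v, h1, h2⟩ = v 0 :: l := by
    simp [tt, hl, List.ofFn_succ]
  have hlen : l.length = 8 := by simp [hl]
  have hs : l.sum = 3 * v 0 - 1 := by
    simp [B, Kcl, Fin.succ_ne_zero] at h2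
    rw [hl, List.sum_ofFn]; linarith
  have hq : sumsq l = v 0 * v 0 + 1 := by
    simp only [B] at h1
    rw [sumsq, hl, List.map_ofFn, List.sum_ofFn]
    simp only [Function.comp_apply]; linarith
  have hc := cs l
  rw [hs, hq, hlen] at hc
  push_cast at hc
  have a1 : -1 ≤ v 0 := by nlinarith
  have a2 : v 0 ≤ 7 := by nlinarith
  have hmem : ∀ x ∈ l, x ∈ rng := by
    intro x hx
    have : x * x ≤ sumsq l :=
      List.single_le_sum (by
        intro y hy
        obtain ⟨z, -, rfl⟩ := List.mem_map.mp hy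
        exact mul_self_nonneg z) _ (List.mem_map.mpr ⟨x, hx, rfl⟩)
    rw [hq] at this
    have : x * x ≤ 50 := by nlinarith
    exact mem_rng (by nlinarith) (by nlinarith)
  have hg := mem_gen l hmem
  rw [hlen, hs, hq] at hg
  rw [htt, LG, List.mem_flatMap]
  refine ⟨v 0, mem_rng (by linarith) a2, ?_⟩
  rw [if_neg (by linarith)]
  exact List.mem_map.mpr ⟨l, hg, rfl⟩

lemma exists_tt {l : List ℤ} (h : l ∈ LL) : ∃ x : Exc, tt x = l := by
  obtain ⟨h1, h2, h3⟩ := LL_ok l h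
  have e : List.ofFn (fun i : Fin 9 => l.get (i.cast h1.symm)) = l := by
    apply List.ext_getElem
    · simp only [List.length_ofFn, h1]
    · intro i h h'
      rw [List.getElem_ofFn]
      rfl
  refine ⟨⟨fun i : Fin 9 => l.get (i.cast h1.symm), ?_, ?_⟩, e⟩
  · rw [← Bl_ofFn, e, h2]
  · rw [← Bl_ofFn, e, ← h3]
    congr 1

lemma exists_map_tt (m : List (List ℤ)) (h : ∀ l ∈ m, l ∈ LL) : ∃ U : List Exc, U.map tt = m := by
  induction m with
  | nil => exact ⟨[], rfl⟩
  | cons a m ih =>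
    obtain ⟨U, hU⟩ := ih fun l hl => h l (List.mem_cons_of_mem _ hl)
    obtain ⟨x, hx⟩ := exists_tt (h a (by simp))
    exact ⟨x :: U, by simp [hU, hx]⟩

lemma prof_nodup' : (LL.map fun z => cL.map fun x => Bl x z).Nodup := by
  have h := prof_nodup
  have e : (LL.map fun z => encL (cL.map fun x => Bl x z)) =
    (LL.map fun z => cL.map fun x => Bl x z).map encL := by simp
  rw [e] at h
  exact h.of_map _

lemma LL_nodup : LL.Nodup := prof_nodup'.of_map _

/-! ### Generic facts on frames -/

lemma cand_map {α β : Type} {b : α → α → ℤ} {b' : β → β → ℤ} {t : α → β}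
    (h : ∀ x y, b' (t x) (t y) = b x y) (p : List α) (y : α) :
    cand b' (p.map t) (t y) = cand b p y := by
  simp [cand, Function.comp_def, h]

lemma Fr_map {α β : Type} {b : α → α → ℤ} {b' : β → β → ℤ} {t : α → β}
    (h : ∀ x y, b' (t x) (t y) = b x y) (p : List α) :
    Fr b' (p.map t) = Fr b p := by
  induction p with
  | nil => rfl
  | cons a p ih => simp only [List.map_cons, Fr, ih, cand_map h]

lemma enum_map {α β : Type} {b : α → α → ℤ} {b' : β → β → ℤ} {t : α → β}
    (h : ∀ x y, b' (t x) (t y) = b x y) (U : List α) (k : ℕ) :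
    enum b' (U.map t) k = (enum b U k).map (List.map t) := by
  induction k with
  | zero => rfl
  | succ k ih =>
    simp only [enum, ih, List.flatMap_map, List.map_flatMap, List.filter_map, List.map_map]
    congr 1
    funext p
    have : (cand b' (p.map t) ∘ t) = cand b p := by funext y; exact cand_map h p y
    rw [this]
    rfl

lemma mem_enum {α : Type} (b : α → α → ℤ) (U : List α) (k : ℕ) (l : List α) :
    l ∈ enum b U k ↔ l.length = k ∧ Fr b l = true ∧ ∀ x ∈ l, x ∈ U := by
  induction k generalizing l with
  | zero =>
    simp only [enum, List.mem_singleton, List.length_eq_zero_iff]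
    constructor
    · rintro rfl; simp [Fr]
    · exact fun h => h.1
  | succ k ih =>
    simp only [enum, List.mem_flatMap, List.mem_map, List.mem_filter, ih]
    constructor
    · rintro ⟨p, ⟨h1, h2, h3⟩, y, ⟨h4, h5⟩, rfl⟩
      simp [Fr, h1, h2, h5, h4]
      exact h3
    · rintro ⟨h1, h2, h3⟩
      cases l with
      | nil => simp at h1
      | cons y p =>
        simp [Fr] at h1 h2 h3
        exact ⟨p, ⟨h1, h2.1, h3.2⟩, y, ⟨h3.1, h2.2⟩, rfl⟩

lemma enum_nodup {α : Type} (b : α → α → ℤ) (U : List α) (hU : U.Nodup) (k : ℕ) :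
    (enum b U k).Nodup := by
  induction k with
  | zero => simp [enum]
  | succ k ih =>
    rw [enum, List.nodup_flatMap]
    refine ⟨fun p _ => (hU.filter _).map fun x y h => by simpa using h, ?_⟩
    refine ih.imp ?_
    intro p q hpq l h1 h2
    obtain ⟨y, -, rfl⟩ := List.mem_map.mp h1
    obtain ⟨z, -, hz⟩ := List.mem_map.mp h2
    simp at hz
    exact hpq hz.2.symm
/-! ### The group `W` and reflections -/

lemma B_comm (v w : Fin 9 → ℤ) : B v w = B w v := by
  simp only [B, mul_comm]

lemma Bx_comm (x y : Exc) : Bx x y = Bx y x := B_comm _ _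

lemma B_lin (v r w : Fin 9 → ℤ) (s : ℤ) : B (v + s • r) w = B v w + s * B r w := by
  simp only [B, Pi.add_apply, Pi.smul_apply, smul_eq_mul, Fin.sum_univ_succ]
  simp
  ring

lemma B_lin' (v r w : Fin 9 → ℤ) (s : ℤ) : B w (v + s • r) = B w v + s * B w r := by
  rw [B_comm, B_lin, B_comm v, B_comm r]

lemma B_sub' (w x y : Fin 9 → ℤ) : B w (x - y) = B w x - B w y := by
  have := B_lin' x y w (-1)
  rw [show x + (-1 : ℤ) • y = x - y by simp [sub_eq_add_neg]] at this
  rw [this]; ring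

def rf (r v : Fin 9 → ℤ) : Fin 9 → ℤ := v + B v r • r

lemma rf_B (r v w : Fin 9 → ℤ) (hr : B r r = -2) : B (rf r v) (rf r w) = B v w := by
  simp only [rf, B_lin, B_lin', hr, B_comm r w]
  ring

lemma rf_rf (r v : Fin 9 → ℤ) (hr : B r r = -2) : rf r (rf r v) = v := by
  have : B (rf r v) r = - B v r := by
    simp only [rf, B_lin, hr]; ring
  rw [rf, this]
  simp [rf]

lemma rf_exc (r v : Fin 9 → ℤ) (hr : B r r = -2) (hK : B r Kcl = 0) (hv : IsExc v) :
    IsExc (rf r v) := by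
  refine ⟨?_, ?_⟩
  · rw [rf_B _ _ _ hr, hv.1]
  · rw [rf, B_lin, hK, hv.2]; ring

lemma exists_refl (x y : Exc) (h : Bx x y = 0) :
    ∃ g : Exc ≃ Exc, PreservesB g ∧ g x = y ∧ ∀ z, Bx z x = Bx z y → g z = z := by
  have h' : B x.1 y.1 = 0 := h
  have hr : B (x.1 - y.1) (x.1 - y.1) = -2 := by
    rw [B_sub', B_comm _ x.1, B_comm _ y.1, B_sub', B_sub', x.2.1, y.2.1, h', B_comm y.1, h']
    norm_num
  have hK : B (x.1 - y.1) Kcl = 0 := by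
    rw [B_comm, B_sub', B_comm, x.2.2, B_comm, y.2.2]; norm_num
  let f : Exc → Exc := fun v => ⟨rf (x.1 - y.1) v.1, rf_exc _ _ hr hK v.2⟩
  have hf : Function.Involutive f := fun v => Subtype.ext (rf_rf _ _ hr)
  refine ⟨hf.toPerm, fun v w => rf_B _ _ _ hr, ?_, ?_⟩
  · apply Subtype.ext
    change rf (x.1 - y.1) x.1 = y.1
    rw [rf, B_sub', x.2.1, h']
    funext i
    simp
  · intro z hz
    apply Subtype.ext
    change rf (x.1 - y.1) z.1 = z.1
    have : B z.1 x.1 = B z.1 y.1 := hz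
    rw [rf, B_sub', this]
    simp

lemma W_trans {g h : Exc ≃ Exc} (hg : PreservesB g) (hh : PreservesB h) :
    PreservesB (g.trans h) := fun x y => by
  simp only [Equiv.trans_apply]; rw [hh, hg]

lemma W_symm {g : Exc ≃ Exc} (hg : PreservesB g) : PreservesB g.symm := fun x y => by
  have := hg (g.symm x) (g.symm y)
  simpa using this.symm

/-! ### Orbits of frames -/

/-- `y` can be moved to `z` by an element of `W` fixing `p` pointwise -/
def Mv (p : List Exc) (y z : Exc) : Prop :=
  ∃ g : Exc ≃ Exc, PreservesB g ∧ p.map g = p ∧ g y = z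

lemma Mv_refl (p : List Exc) (y : Exc) : Mv p y y :=
  ⟨Equiv.refl _, fun _ _ => rfl, by simp, rfl⟩

lemma Mv_trans {p : List Exc} {x y z : Exc} (h1 : Mv p x y) (h2 : Mv p y z) : Mv p x z := by
  obtain ⟨g, a1, a2, a3⟩ := h1
  obtain ⟨h, b1, b2, b3⟩ := h2
  refine ⟨g.trans h, W_trans a1 b1, ?_, by simp [a3, b3]⟩
  have : p.map (g.trans h) = (p.map g).map h := by simp
  rw [this, a2, b2]

lemma Mv_of_zero {p : List Exc} {y z : Exc} (hy : cand Bx p y = true) (hz : cand Bx p z = true)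
    (h : Bx y z = 0) : Mv p y z := by
  obtain ⟨g, h1, h2, h3⟩ := exists_refl y z h
  refine ⟨g, h1, ?_, h2⟩
  simp only [cand, decide_eq_true_eq] at hy hz
  have e := hy.trans hz.symm
  rw [List.map_inj_left] at e
  conv_rhs => rw [← List.map_id p]
  rw [List.map_inj_left]
  intro a ha
  exact h3 a (e a ha)

lemma cand_tt (p : List Exc) (y : Exc) : cand Bl (p.map tt) (tt y) = cand Bx p y :=
  cand_map (fun x y => (Bx_tt x y).symm) p y

lemma mem_XL (p : List Exc) (y : Exc) : tt y ∈ XL (p.map tt) ↔ cand Bx p y = true := by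
  simp [XL, List.mem_filter, tt_mem, cand_tt]

/-- every element of the list is a class which can be moved to an element of `H` -/
def Good (p : List Exc) (H cur : List (List ℤ)) : Prop :=
  ∀ l ∈ cur, ∃ y : Exc, tt y = l ∧ cand Bx p y = true ∧ ∃ z, tt z ∈ H ∧ Mv p y z

lemma Good_step (p : List Exc) (H cur : List (List ℤ)) (h : Good p H cur) :
    Good p H (stepL (XL (p.map tt)) cur) := by
  intro l hl
  simp only [stepL, List.mem_filter, List.any_eq_true, Bool.or_eq_true, decide_eq_true_eq] at hl
  obtain ⟨h1, m, hm, h2⟩ := hl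
  obtain ⟨w, rfl, hw, z, hz, hwz⟩ := h m hm
  obtain ⟨y, rfl⟩ := exists_tt (List.mem_filter.mp h1).1
  have hy := (mem_XL p y).mp h1
  refine ⟨y, rfl, hy, z, hz, ?_⟩
  rcases h2 with h2 | h2
  · rw [← Bx_tt, Bx_comm] at h2
    exact Mv_trans (Mv_of_zero hy hw h2) hwz
  · rw [← tt_inj h2]; exact hwz

def Can (k : ℕ) (p : List Exc) : Prop := p.map tt ∈ preS k

lemma step_canon {k : ℕ} (hk : k < 10) (p : List Exc) (hp : Can k p) (y : Exc)
    (hy : cand Bx p y = true) : ∃ z, Mv p y z ∧ Can (k + 1) (z :: p) := by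
  obtain ⟨h1, h2⟩ := reach_ok k hk _ hp
  have g0 : Good p (heads k (p.map tt)) (heads k (p.map tt)) := by
    intro l hl
    obtain ⟨a, b⟩ := h2 l hl
    obtain ⟨y, rfl⟩ := exists_tt b
    exact ⟨y, rfl, by rwa [cand_tt] at a, y, hl, Mv_refl _ _⟩
  have g3 := Good_step _ _ _ (Good_step _ _ _ (Good_step _ _ _ g0))
  rw [h1] at g3
  obtain ⟨y', e, -, z, hz, hm⟩ := g3 (tt y) ((mem_XL p y).mpr hy)
  rw [tt_inj e] at hm
  refine ⟨z, hm, ?_⟩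
  simp only [heads, List.mem_map, List.mem_filter, decide_eq_true_eq] at hz
  obtain ⟨r, ⟨hr, e1⟩, e2⟩ := hz
  have : r = tt z :: p.map tt := by
    rw [← e1, ← e2]
    have hne : r ≠ [] := by
      rintro rfl
      have := tt_mem z
      rw [← e2] at this
      have := (LL_ok _ this).1
      simp at this
    cases r with
    | nil => exact absurd rfl hne
    | cons a r => simp
  rw [Can, List.map_cons, ← this]
  exact hr

lemma to_canon (l : List Exc) (hl : l.length ≤ 10) (h : Fr Bx l = true) :
    ∃ g : Exc ≃ Exc, PreservesB g ∧ Can l.length (l.map g) := by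
  induction l with
  | nil => exact ⟨Equiv.refl _, fun _ _ => rfl, by simp [Can, preS, preL, cL]⟩
  | cons y p ih =>
    simp only [Fr, Bool.and_eq_true] at h
    simp only [List.length_cons] at hl
    obtain ⟨g, h1, h2⟩ := ih (by omega) h.1
    have hy : cand Bx (p.map g) (g y) = true := by
      rw [cand_map h1]; exact h.2
    obtain ⟨z, ⟨g', a1, a2, a3⟩, hz⟩ := step_canon (by omega) _ h2 _ hy
    refine ⟨g.trans g', W_trans h1 a1, ?_⟩
    have e : p.map (g.trans g') = (p.map g).map g' := by simp
    rw [List.map_cons, e, a2, List.length_cons, Equiv.trans_apply, a3]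
    exact hz

/-! ### Counting frames -/

lemma ext_count (U : List Exc) (hU : U.map tt = LL) (p : List Exc) (hl : p.length < 10)
    (h : Fr Bx p = true) : (U.filter (cand Bx p)).length = nxt p.length := by
  obtain ⟨g, h1, h2⟩ := to_canon p hl.le h
  have c := count_ok _ hl _ h2
  rw [← c, XL, ← hU, List.filter_map, List.length_map]
  have e : (cand Bl ((p.map g).map tt) ∘ tt) = cand Bx (p.map g) := by
    funext y; exact cand_tt _ y
  rw [e]
  have hn : U.Nodup := by
    have := LL_nodup
    rw [← hU] at this
    exact this.of_map _
  have hall : ∀ x, x ∈ U := by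
    intro x
    have := tt_mem x
    rw [← hU, List.mem_map] at this
    obtain ⟨y, hy, e⟩ := this
    rwa [← tt_inj e]
  have pe : (U.map g).Perm U := by
    refine (List.perm_ext_iff_of_nodup (hn.map g.injective) hn).mpr fun a => ?_
    simp only [hall, iff_true]
    exact List.mem_map.mpr ⟨g.symm a, hall _, by simp⟩
  have := (pe.filter (cand Bx (p.map g))).length_eq
  rw [← this, List.filter_map, List.length_map]
  congr 2
  funext y
  exact (cand_map h1 p y).symm

lemma enum_length (U : List Exc) (hU : U.map tt = LL) (k : ℕ) (hk : k < 10) :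
    (enum Bx U (k + 1)).length = (enum Bx U k).length * nxt k := by
  rw [enum, List.length_flatMap]
  have : (enum Bx U k).map (fun p => ((U.filter (cand Bx p)).map (· :: p)).length) =
      (enum Bx U k).map (fun _ => nxt k) := by
    rw [List.map_inj_left]
    intro p hp
    obtain ⟨h1, h2, -⟩ := (mem_enum _ _ _ _).mp hp
    rw [List.length_map, ext_count U hU p (by omega) h2, h1]
  rw [this]
  simp

lemma enum_total (U : List Exc) (hU : U.map tt = LL) :
    (enum Bx U 10).length = 1393459200 := by
  rw [enum_length U hU 9 (by norm_num), enum_length U hU 8 (by norm_num),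
    enum_length U hU 7 (by norm_num), enum_length U hU 6 (by norm_num),
    enum_length U hU 5 (by norm_num), enum_length U hU 4 (by norm_num),
    enum_length U hU 3 (by norm_num), enum_length U hU 2 (by norm_num),
    enum_length U hU 1 (by norm_num), enum_length U hU 0 (by norm_num)]
  simp [enum, nxt]

/-! ### Frames and cliques -/

instance (i j : Fin 10) : Decidable (adjCC i j) := by unfold adjCC; infer_instance

def lst (f : Fin 10 → Exc) : List Exc := [f 9, f 8, f 7, f 6, f 5, f 4, f 3, f 2, f 1, f 0]

lemma adj_symm (i j : Fin 10) : adjCC i j ↔ adjCC j i := by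
  unfold adjCC; constructor <;> (rintro ⟨h, h'⟩; exact ⟨h.symm, h'.symm⟩)

lemma frame_fn1 (f : Fin 10 → Exc)
    (h : ∀ i j : Fin 10, i < j → Bx (f i) (f j) = if adjCC i j then 2 else 1) :
    Fr Bx (lst f) = true := by
  simp only [lst, Fr, cand, List.map_cons, List.map_nil, List.length_cons, List.length_nil,
    Bool.and_eq_true, decide_eq_true_eq]
  simp only [row, Nat.reduceAdd, zero_add]
  simp (discharger := decide) only [h]
  decide

lemma frame_fn2 (f : Fin 10 → Exc) (h : Fr Bx (lst f) = true) :
    ∀ i j : Fin 10, i < j → Bx (f i) (f j) = if adjCC i j then 2 else 1 := by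
  simp only [lst, Fr, cand, List.map_cons, List.map_nil, List.length_cons, List.length_nil,
    Bool.and_eq_true, decide_eq_true_eq] at h
  simp only [row, Nat.reduceAdd, zero_add, List.cons.injEq, and_true, true_and] at h
  intro i j hij
  fin_cases i <;> fin_cases j <;> first
    | (exfalso; revert hij; decide)
    | (simp only [Fin.reduceFinMk, Fin.zero_eta, Fin.mk_one, Fin.isValue] at *
       simp (decide := true) only [h, if_true, if_false])

lemma row_mem (k : ℕ) : ∀ r ∈ row k, r = 1 ∨ r = 2 := by
  unfold row
  split <;> simp

lemma Fr_nodup (l : List Exc) (h : Fr Bx l = true) : l.Nodup := by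
  induction l with
  | nil => simp
  | cons y p ih =>
    simp only [Fr, Bool.and_eq_true] at h
    refine List.nodup_cons.mpr ⟨fun hy => ?_, ih h.1⟩
    have hc := h.2
    simp only [cand, decide_eq_true_eq] at hc
    have hm : Bx y y ∈ row p.length := by
      rw [← hc]; exact List.mem_map.mpr ⟨y, hy, rfl⟩
    have : Bx y y = -1 := y.2.1
    rcases row_mem _ _ hm with h | h <;> omega

lemma lst_surj (l : List Exc) (h : l.length = 10) : ∃ f, l = lst f := by
  refine ⟨fun i => l.get ((Fin.rev i).cast h.symm), ?_⟩
  match l, h with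
  | [a, b, c, d, e, f, g, i, j, k], _ => rfl

/-- the cliques in question -/
def Cl (S : Finset Exc) : Prop := S.card = 10 ∧ IsClique {1, 2} S ∧ HasWeight2Graph adjCC S

lemma mem_lst (f : Fin 10 → Exc) (x : Exc) : x ∈ lst f ↔ ∃ i, f i = x := by
  simp only [lst, List.mem_cons, List.not_mem_nil, or_false]
  constructor
  · rintro (h | h | h | h | h | h | h | h | h | h) <;> exact ⟨_, h.symm⟩
  · rintro ⟨i, rfl⟩
    fin_cases i <;> simp

lemma Cl_iff (S : Finset Exc) :
    Cl S ↔ ∃ l : List Exc, l.length = 10 ∧ Fr Bx l = true ∧ l.toFinset = S := by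
  constructor
  · rintro ⟨h1, h2, σ, h3⟩
    refine ⟨lst fun i => (σ i).1, rfl, frame_fn1 _ ?_, ?_⟩
    · intro i j hij
      have hne : (σ i).1 ≠ (σ j).1 := fun h => hij.ne (σ.injective (Subtype.ext h))
      have h4 := h2 _ (σ i).2 _ (σ j).2 hne
      have h5 := h3 i j hij.ne
      simp only [Set.mem_insert_iff, Set.mem_singleton_iff] at h4
      split_ifs with h6
      · exact h5.mpr h6
      · exact h4.resolve_right fun h => h6 (h5.mp h)
    · ext x
      rw [List.mem_toFinset, mem_lst]
      constructor
      · rintro ⟨i, rfl⟩; exact (σ i).2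
      · intro hx
        exact ⟨σ.symm ⟨x, hx⟩, by simp⟩
  · rintro ⟨l, h1, h2, rfl⟩
    have hn := Fr_nodup l h2
    have hcard : l.toFinset.card = 10 := by rw [List.toFinset_card_of_nodup hn, h1]
    obtain ⟨f, rfl⟩ := lst_surj l h1
    have h3 := frame_fn2 f h2
    have h4 : ∀ i j : Fin 10, i ≠ j → Bx (f i) (f j) = if adjCC i j then 2 else 1 := by
      intro i j hij
      rcases lt_or_gt_of_ne hij with h | h
      · exact h3 i j h
      · rw [Bx_comm, h3 j i h]
        simp only [adj_symm i j]
    have hf : Function.Injective f := by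
      intro i j hij
      by_contra hne
      have := h4 i j hne
      rw [hij] at this
      have h' : Bx (f j) (f j) = -1 := (f j).2.1
      split_ifs at this <;> omega
    refine ⟨hcard, ?_, ?_⟩
    · intro x hx y hy hxy
      rw [List.mem_toFinset, mem_lst] at hx hy
      obtain ⟨i, rfl⟩ := hx
      obtain ⟨j, rfl⟩ := hy
      rw [h4 i j fun h => hxy (by rw [h])]
      split_ifs <;> simp
    · refine ⟨Equiv.ofBijective (fun i => ⟨f i, by
        rw [List.mem_toFinset, mem_lst]; exact ⟨i, rfl⟩⟩) ⟨?_, ?_⟩, ?_⟩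
      · intro i j h
        exact hf (congrArg Subtype.val h)
      · rintro ⟨x, hx⟩
        rw [List.mem_toFinset, mem_lst] at hx
        obtain ⟨i, rfl⟩ := hx
        exact ⟨i, rfl⟩
      · intro i j hij
        change Bx (f i) (f j) = 2 ↔ adjCC i j
        rw [h4 i j hij]
        split_ifs with h <;> simp [h]

/-! ### The base frame -/

lemma tau_map {α β : Type} (f : α → β) (l : List α) : tau (l.map f) = (tau l).map f := by
  simp [tau, List.map_take, List.map_drop]

lemma tau_tau {α : Type} (l : List α) (h : l.length = 10) : tau (tau l) = l := by
  match l, h with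
  | [a, b, c, d, e, f, g, i, j, k], _ => rfl

lemma mem_tau {α : Type} (l : List α) (x : α) : x ∈ tau l ↔ x ∈ l := by
  conv_rhs => rw [← List.take_append_drop 4 l]
  simp only [tau, List.mem_append, List.mem_reverse]

lemma toFinset_map (l : List Exc) (g : Exc ≃ Exc) :
    (l.map g).toFinset = l.toFinset.image g := by
  ext x; simp

lemma tau_toFinset (l : List Exc) : (tau l).toFinset = l.toFinset := by
  ext x; simp [mem_tau]

/-- any frame is equivalent to the base frame or its reflection -/
lemma frame_orbit (c : List Exc) (hc : c.map tt = cL) (l : List Exc) (h1 : l.length = 10)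
    (h2 : Fr Bx l = true) :
    ∃ g : Exc ≃ Exc, PreservesB g ∧ (l = c.map g ∨ l = (tau c).map g) := by
  obtain ⟨g, h3, h4⟩ := to_canon l h1.le h2
  refine ⟨g.symm, W_symm h3, ?_⟩
  have inj : Function.Injective (List.map tt) := List.map_injective_iff.mpr tt_inj
  have key : ∀ d : List Exc, l.map g = d → l = d.map g.symm := by
    rintro d rfl
    simp
  rw [h1] at h4
  rw [Can, preS, if_neg (by norm_num)] at h4
  simp only [preL, Nat.sub_self, List.drop_zero, List.mem_cons, List.not_mem_nil,
    or_false] at h4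
  rcases h4 with h | h
  · left
    exact key _ (inj (h.trans hc.symm))
  · right
    rw [← hc, tau_map] at h
    exact key _ (inj h)

lemma base_unique (c : List Exc) (hc : c.map tt = cL) (g h : Exc ≃ Exc) (hg : PreservesB g)
    (hh : PreservesB h) (e : c.map g = c.map h) : g = h := by
  rw [List.map_inj_left] at e
  ext1 z
  have key : ∀ w, (cL.map fun x => Bl x (tt w)) = c.map fun x => Bx x w := by
    intro w
    rw [← hc, List.map_map, List.map_inj_left]
    intro a _
    exact (Bx_tt a w).symm
  have hinj := List.inj_on_of_nodup_map prof_nodup'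
  have : h.symm (g z) = z := by
    apply tt_inj
    apply hinj (tt_mem _) (tt_mem _)
    rw [key, key, List.map_inj_left]
    intro a ha
    rw [← hh, Equiv.apply_symm_apply, ← e a ha, hg]
  exact (Equiv.symm_apply_eq h).mp this

lemma base_ne (c : List Exc) (hc : c.map tt = cL) (g : Exc ≃ Exc) (hg : PreservesB g) :
    c.map g ≠ tau c := by
  intro e
  obtain ⟨z, hz, h⟩ := prof_ne
  obtain ⟨z, rfl⟩ := exists_tt hz
  apply h (tt (g z)) (tt_mem _)
  rw [← hc, tau_map, ← e]
  simp only [List.map_map, List.map_inj_left]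
  intro a _
  simp only [Function.comp_apply]
  rw [← Bx_tt, ← Bx_tt, hg]

lemma exists_base : ∃ c : List Exc, c.map tt = cL := exists_map_tt _ cL_sub

lemma base_len (c : List Exc) (hc : c.map tt = cL) : c.length = 10 := by
  rw [← List.length_map (f := tt), hc]; rfl

lemma base_fr (c : List Exc) (hc : c.map tt = cL) : Fr Bx c = true := by
  rw [← Fr_map (b' := Bl) (t := tt) (fun x y => (Bx_tt x y).symm), hc]; exact c_mem

lemma base_fr' (c : List Exc) (hc : c.map tt = cL) : Fr Bx (tau c) = true := by
  rw [← Fr_map (b' := Bl) (t := tt) (fun x y => (Bx_tt x y).symm), ← tau_map, hc]; exact tau_mem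

/-- frames enumerating a given clique -/
lemma fiber (c : List Exc) (hc : c.map tt = cL) (S : Finset Exc) (hS : Cl S) :
    ∃ F : Finset (List Exc), F.card = 200 ∧
      ∀ l, l ∈ F ↔ l.length = 10 ∧ Fr Bx l = true ∧ l.toFinset = S := by
  obtain ⟨l0, h1, h2, rfl⟩ := (Cl_iff S).mp hS
  have hd : ∃ d : List Exc, d.Nodup ∧ d.length = 10 ∧ d.toFinset = l0.toFinset ∧
      (enum Bx d 10).length = 200 := by
    obtain ⟨g, hg, h⟩ := frame_orbit c hc l0 h1 h2
    refine ⟨c.map g, ?_, ?_, ?_, ?_⟩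
    · exact (Fr_nodup c (base_fr c hc)).map g.injective
    · simp [base_len c hc]
    · rcases h with rfl | rfl
      · rfl
      · rw [toFinset_map, toFinset_map, tau_toFinset]
    · rw [enum_map hg, List.length_map]
      have := enum_c
      rw [← hc, enum_map (b := Bx) (fun x y => (Bx_tt x y).symm), List.length_map] at this
      exact this
  obtain ⟨d, d1, d2, d3, d4⟩ := hd
  refine ⟨(enum Bx d 10).toFinset, ?_, ?_⟩
  · rw [List.toFinset_card_of_nodup (enum_nodup _ _ d1 _), d4]
  · intro l
    rw [List.mem_toFinset, mem_enum, ← d3]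
    constructor
    · rintro ⟨a1, a2, a3⟩
      refine ⟨a1, a2, ?_⟩
      apply Finset.eq_of_subset_of_card_le
      · intro x hx
        rw [List.mem_toFinset] at hx ⊢
        exact a3 x hx
      · rw [List.toFinset_card_of_nodup d1, List.toFinset_card_of_nodup (Fr_nodup l a2), a1, d2]
    · rintro ⟨a1, a2, a3⟩
      refine ⟨a1, a2, fun x hx => ?_⟩
      rw [← List.mem_toFinset, ← a3, List.mem_toFinset]
      exact hx

lemma part1 : {S : Finset Exc | S.card = 10 ∧ IsClique {1, 2} S ∧
    HasWeight2Graph adjCC S}.ncard = 6967296 := by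
  obtain ⟨c, hc⟩ := exists_base
  obtain ⟨U, hU⟩ := exists_map_tt LL fun _ h => h
  have hn : U.Nodup := by
    have := LL_nodup
    rw [← hU] at this
    exact this.of_map _
  have hall : ∀ x, x ∈ U := by
    intro x
    have := tt_mem x
    rw [← hU, List.mem_map] at this
    obtain ⟨y, hy, e⟩ := this
    rwa [← tt_inj e]
  generalize hF : (enum Bx U 10).toFinset = F
  have hFc : F.card = 1393459200 := by
    rw [← hF, List.toFinset_card_of_nodup (enum_nodup _ _ hn _), enum_total U hU]
  have hFm : ∀ l, l ∈ F ↔ l.length = 10 ∧ Fr Bx l = true := by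
    intro l
    rw [← hF, List.mem_toFinset, mem_enum]
    simp [hall]
  have hset : {S : Finset Exc | S.card = 10 ∧ IsClique {1, 2} S ∧
      HasWeight2Graph adjCC S} = ↑(F.image List.toFinset) := by
    ext S
    rw [Finset.mem_coe, Finset.mem_image]
    refine (Cl_iff S).trans ?_
    simp only [hFm, and_assoc]
  rw [hset, Set.ncard_coe_finset]
  have h := Finset.card_eq_sum_card_image List.toFinset F
  rw [Finset.sum_const_nat (m := 200)] at h
  · rw [hFc] at h; omega
  · intro S hS
    have hS' : Cl S := by
      rw [Cl_iff]
      obtain ⟨l, hl, e⟩ := Finset.mem_image.mp hS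
      exact ⟨l, ((hFm l).mp hl).1, ((hFm l).mp hl).2, e⟩
    obtain ⟨F', h1, h2⟩ := fiber c hc S hS'
    rw [← h1]
    congr 1
    ext l
    rw [Finset.mem_filter, hFm, h2, and_assoc]

lemma from_base (c : List Exc) (hc : c.map tt = cL) (S : Finset Exc) (hS : Cl S) :
    ∃ g : Exc ≃ Exc, PreservesB g ∧ (c.map g).toFinset = S := by
  obtain ⟨l, h1, h2, rfl⟩ := (Cl_iff S).mp hS
  obtain ⟨g, hg, rfl | rfl⟩ := frame_orbit c hc l h1 h2
  · exact ⟨g, hg, rfl⟩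
  · exact ⟨g, hg, by rw [toFinset_map, toFinset_map, tau_toFinset]⟩

lemma part2 (S T : Finset Exc) (hS : Cl S) (hT : Cl T) : SameOrbit S T := by
  obtain ⟨c, hc⟩ := exists_base
  obtain ⟨g, hg, rfl⟩ := from_base c hc S hS
  obtain ⟨h, hh, rfl⟩ := from_base c hc T hT
  refine ⟨g.symm.trans h, W_trans (W_symm hg) hh, ?_⟩
  rw [← toFinset_map, List.map_map]
  congr 2
  funext x
  simp

lemma part3 (S : Finset Exc) (hS : Cl S) :
    {g : Exc ≃ Exc | PreservesB g ∧ S.image g = S}.ncard = 100 := by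
  classical
  obtain ⟨c, hc⟩ := exists_base
  obtain ⟨F, hF, hm⟩ := fiber c hc S hS
  obtain ⟨h, hh, hcS⟩ := from_base c hc S hS
  have len := base_len c hc
  generalize hA : F.filter (fun l => ∃ g : Exc ≃ Exc, PreservesB g ∧ l = c.map g) = A
  generalize hA' : F.filter (fun l => ∃ g : Exc ≃ Exc, PreservesB g ∧ l = (tau c).map g) = A'
  have hmA : ∀ l, l ∈ A ↔ l ∈ F ∧ ∃ g : Exc ≃ Exc, PreservesB g ∧ l = c.map g := by
    intro l; rw [← hA, Finset.mem_filter]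
  have hmA' : ∀ l, l ∈ A' ↔ l ∈ F ∧ ∃ g : Exc ≃ Exc, PreservesB g ∧ l = (tau c).map g := by
    intro l; rw [← hA', Finset.mem_filter]
  have hU : A ∪ A' = F := by
    ext l
    rw [Finset.mem_union, hmA, hmA']
    constructor
    · rintro (h | h) <;> exact h.1
    · intro hl
      obtain ⟨h1, h2, -⟩ := (hm l).mp hl
      obtain ⟨g, hg, e | e⟩ := frame_orbit c hc l h1 h2
      · exact Or.inl ⟨hl, g, hg, e⟩
      · exact Or.inr ⟨hl, g, hg, e⟩
  have hdis : Disjoint A A' := by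
    rw [Finset.disjoint_left]
    intro l h1 h2
    obtain ⟨-, g, hg, e⟩ := (hmA l).mp h1
    obtain ⟨-, g', hg', e'⟩ := (hmA' l).mp h2
    apply base_ne c hc (g.trans g'.symm) (W_trans hg (W_symm hg'))
    have : c.map (g.trans g'.symm) = (c.map g).map g'.symm := by simp
    rw [this, ← e, e']
    simp
  have hAA : A' = A.image tau := by
    ext l
    rw [Finset.mem_image]
    constructor
    · intro hl
      obtain ⟨h1, g, hg, rfl⟩ := (hmA' l).mp hl
      refine ⟨c.map g, (hmA _).mpr ⟨(hm _).mpr ⟨by simp [len], ?_, ?_⟩, g, hg, rfl⟩, tau_map _ _⟩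
      · rw [Fr_map hg]; exact base_fr c hc
      · rw [← ((hm _).mp h1).2.2, toFinset_map, toFinset_map, tau_toFinset]
    · rintro ⟨l, hl, rfl⟩
      obtain ⟨h1, g, hg, rfl⟩ := (hmA l).mp hl
      rw [tau_map]
      refine (hmA' _).mpr ⟨(hm _).mpr ⟨by simp [tau, len], ?_, ?_⟩, g, hg, rfl⟩
      · rw [Fr_map hg]; exact base_fr' c hc
      · rw [← ((hm _).mp h1).2.2, toFinset_map, toFinset_map, tau_toFinset]
  have hcard : A'.card = A.card := by
    rw [hAA]
    apply Finset.card_image_of_injOn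
    intro l hl m hm' e
    have h1 := ((hm _).mp ((hmA l).mp hl).1).1
    have h2 := ((hm _).mp ((hmA m).mp hm').1).1
    rw [← tau_tau l h1, ← tau_tau m h2]
    exact congrArg tau e
  have hA100 : A.card = 100 := by
    have := Finset.card_union_of_disjoint hdis
    rw [hU, hF, hcard] at this
    omega
  rw [← hA100, ← Set.ncard_coe_finset]
  refine Set.ncard_congr (fun g _ => c.map (h.trans g)) ?_ ?_ ?_
  · rintro g ⟨hg, hgS⟩
    have hW := W_trans hh hg
    refine (hmA _).mpr ⟨(hm _).mpr ⟨by simp [len], ?_, ?_⟩, _, hW, rfl⟩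
    · rw [Fr_map hW]; exact base_fr c hc
    · have : c.map (h.trans g) = (c.map h).map g := by simp
      rw [this, toFinset_map, hcS, hgS]
  · rintro g g' ⟨hg, -⟩ ⟨hg', -⟩ e
    have := base_unique c hc _ _ (W_trans hh hg) (W_trans hh hg') e
    ext1 x
    have := congrArg (fun k : Exc ≃ Exc => k (h.symm x)) this
    simpa using this
  · intro l hl
    obtain ⟨h1, g, hg, rfl⟩ := (hmA l).mp hl
    refine ⟨h.symm.trans g, ⟨W_trans (W_symm hh) hg, ?_⟩, ?_⟩
    · rw [← ((hm _).mp h1).2.2]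
      conv_lhs => rw [((hm _).mp h1).2.2, ← hcS]
      rw [← toFinset_map, List.map_map]
      congr 2
      funext x
      simp
    · congr 1
      funext x
      simp

/-- There are exactly 6,967,296 ten-element cliques in `C` with weights in `{1,2}` whose
weight-2 graph is a disjoint union of two 5-cycles; they form a single `W`-orbit, and the
stabilizer in `W` of any such clique has order 100. -/
theorem stmt14 :
    {S : Finset Exc | S.card = 10 ∧ IsClique {1, 2} S ∧ HasWeight2Graph adjCC S}.ncard
        = 6967296 ∧
    (∀ S T : Finset Exc,
      S.card = 10 → IsClique {1, 2} S → HasWeight2Graph adjCC S →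
      T.card = 10 → IsClique {1, 2} T → HasWeight2Graph adjCC T →
      SameOrbit S T) ∧
    ∀ S : Finset Exc, S.card = 10 → IsClique {1, 2} S → HasWeight2Graph adjCC S →
      {g : Exc ≃ Exc | PreservesB g ∧ S.image g = S}.ncard = 100 := by
  exact ⟨part1, fun S T a b c d e f => part2 S T ⟨a, b, c⟩ ⟨d, e, f⟩,
    fun S a b c => part3 S ⟨a, b, c⟩⟩
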